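/- Let $u$ be a tempered distribution on $\mathbb{R}^d$ whose Fourier transform is supported in $\{\xi:|\xi|\le 2r\}$ for some $r>0$, and suppose $u$ is a bounded continuous function. Let $0<t<\infty$ and $\sigma\ge d/t$. Then there is a constant $C$ (depending on $d,t,\sigma$ but not on $r$ or $u$) such that for all $x\in\mathbb{R}^d$: $\sup_{y\in\mathbb{R}^d}\frac{|u(x+y)|}{(1+r|y|)^\sigma}\le C\,\big(\mathcal{M}(|u|^t)(x)\big)^{1/t}$, where $\mathcal{M}$ denotes the Hardy--Littlewood maximal operator. -/

import Mathlib

open MeasureTheory Real Complex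
open scoped FourierTransform ENNReal

noncomputable section

abbrev Ed (d : ℕ) := EuclideanSpace ℝ (Fin d)

/-- Average of `f` over the ball `B(x,R)`. -/
noncomputable def ballAvg (d : ℕ) (f : Ed d → ℝ) (x : Ed d) (R : ℝ) : ℝ :=
  (volume (Metric.ball x R)).toReal⁻¹ * ∫ z in Metric.ball x R, f z

/-- Hardy–Littlewood maximal function. -/
noncomputable def HLM (d : ℕ) (f : Ed d → ℝ) (x : Ed d) : ℝ :=
  ⨆ R : {R : ℝ // 0 < R}, ballAvg d f x R.1

open Filter Topology

/-- Change of variables. -/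
theorem aux_cov {d : ℕ} (G : Ed d → ℂ) (R : ℝ) (hR : 0 < R) (w : Ed d) :
    ∫ v : Ed d, ((R : ℂ) ^ d) * G (R • (v - w)) = ∫ z, G z := by
  rw [integral_const_mul, integral_sub_right_eq_self (fun v => G (R • v)) w,
    Measure.integral_comp_smul]
  have h : (0:ℝ) < R ^ d := by positivity
  simp only [finrank_euclideanSpace, Fintype.card_fin]
  rw [abs_of_pos (inv_pos.2 h), Complex.real_smul]
  push_cast
  have : (R : ℂ) ^ d ≠ 0 := by
    apply pow_ne_zero; exact_mod_cast hR.ne'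
  rw [← mul_assoc, mul_inv_cancel₀ this, one_mul]

theorem aux_psi (d : ℕ) : ∃ ψ : SchwartzMap (Ed d) ℂ, ∀ ξ : Ed d, ‖ξ‖ ≤ 2 → 𝓕 ⇑ψ ξ = 1 := by
  let b : ContDiffBump (0 : Ed d) := ⟨2, 3, by norm_num, by norm_num⟩
  let f : Ed d → ℂ := fun x => ((b x : ℝ) : ℂ)
  have hf1 : HasCompactSupport f := b.hasCompactSupport.comp_left (g := fun x : ℝ => (x : ℂ)) (by simp)
  have hf2 : ContDiff ℝ (⊤ : ℕ∞) f := Complex.ofRealCLM.contDiff.comp b.contDiff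
  refine ⟨𝓕⁻ (hf1.toSchwartzMap hf2), fun ξ hξ => ?_⟩
  rw [← SchwartzMap.fourier_coe, FourierTransform.fourier_fourierInv_eq]
  change ((b ξ : ℝ) : ℂ) = 1
  rw [b.one_of_mem_closedBall (by simpa using hξ)]
  simp

theorem aux_dil {d : ℕ} (ψ : SchwartzMap (Ed d) ℂ) (R : ℝ) (hR : 0 < R) (w : Ed d) :
    ∃ φ : SchwartzMap (Ed d) ℂ, (∀ v, φ v = ((R : ℂ) ^ d) * ψ (R • (v - w))) ∧
      ∀ ξ, 𝓕 ⇑φ ξ = (𝐞 (-inner ℝ w ξ) : ℂ) * 𝓕 ⇑ψ (R⁻¹ • ξ) := by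
  let e : Ed d ≃L[ℝ] Ed d := ContinuousLinearEquiv.smulLeft (Units.mk0 R hR.ne')
  refine ⟨((R : ℂ) ^ d) • SchwartzMap.compSubConstCLM ℂ w
    (SchwartzMap.compCLMOfContinuousLinearEquiv ℂ e ψ), fun v => ?_, fun ξ => ?_⟩
  · simp [e]
  · have key := aux_cov (fun z => (𝐞 (-inner ℝ w ξ) : ℂ) * ((𝐞 (-inner ℝ z (R⁻¹ • ξ)) : ℂ) * ψ z)) R hR w
    have hsm : ∀ (c : Circle) (a : ℂ), c • a = (c : ℂ) * a := fun c a => rfl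
    rw [Real.fourier_eq, Real.fourier_eq, ← integral_const_mul]
    simp only [hsm]
    refine Eq.trans ?_ key
    congr 1; ext v
    have h1 : ((R:ℂ) ^ d • SchwartzMap.compSubConstCLM ℂ w
      (SchwartzMap.compCLMOfContinuousLinearEquiv ℂ e ψ)) v = (R:ℂ) ^ d * ψ (R • (v - w)) := by
      simp [e]
    rw [h1]
    have h2 : (𝐞 (-inner ℝ v ξ) : ℂ) = (𝐞 (-inner ℝ w ξ) : ℂ) * (𝐞 (-inner ℝ (R • (v - w)) (R⁻¹ • ξ)) : ℂ) := by
      rw [← Circle.coe_mul, ← AddChar.map_add_eq_mul]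
      congr 2
      rw [real_inner_smul_left, real_inner_smul_right, inner_sub_left]
      field_simp
      ring
    rw [h2]; ring

/-- Reproducing formula. -/
theorem aux_repr {d : ℕ} (ψ : SchwartzMap (Ed d) ℂ) (hψ : ∀ ξ : Ed d, ‖ξ‖ ≤ 2 → 𝓕 ⇑ψ ξ = 1)
    (r : ℝ) (hr : 0 < r) (u : Ed d → ℂ) (hu : Continuous u) (B : ℝ) (hB : ∀ x, ‖u x‖ ≤ B)
    (hF : ∀ φ : SchwartzMap (Ed d) ℂ,
        (∀ ξ : Ed d, ‖ξ‖ ≤ 2 * r → 𝓕 ⇑φ ξ = 0) → (∫ x : Ed d, u x * φ x) = 0) (w : Ed d) :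
    u w = ∫ z, u (w + r⁻¹ • z) * ψ z := by
  have hint : ∀ φ : SchwartzMap (Ed d) ℂ, Integrable (fun v => u v * φ v) := fun φ =>
    φ.integrable.bdd_mul hu.aestronglyMeasurable (Eventually.of_forall hB)
  have step : ∀ R, r ≤ R → ∫ z, u (w + R⁻¹ • z) * ψ z = ∫ z, u (w + r⁻¹ • z) * ψ z := by
    intro R hrR
    have hR : 0 < R := hr.trans_le hrR
    have main : ∀ S : ℝ, 0 < S → ∀ φ : SchwartzMap (Ed d) ℂ,
        (∀ v, φ v = ((S : ℂ) ^ d) * ψ (S • (v - w))) →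
        ∫ z, u (w + S⁻¹ • z) * ψ z = ∫ v, u v * φ v := by
      intro S hS φ hφ
      rw [← aux_cov _ S hS w]
      congr 1; ext v
      rw [hφ, smul_smul, inv_mul_cancel₀ hS.ne', one_smul, add_sub_cancel]
      ring
    obtain ⟨φ1, h1, h1'⟩ := aux_dil ψ R hR w
    obtain ⟨φ2, h2, h2'⟩ := aux_dil ψ r hr w
    rw [main R hR φ1 h1, main r hr φ2 h2]
    have := hF (φ1 - φ2) (by
      intro ξ hξ
      rw [← SchwartzMap.fourier_coe, ← FourierTransform.fourierCLM_apply (R := ℂ), map_sub, sub_apply,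
        FourierTransform.fourierCLM_apply, FourierTransform.fourierCLM_apply,
        SchwartzMap.fourier_coe, SchwartzMap.fourier_coe, h1', h2', hψ, hψ, sub_self]
      · rw [norm_smul, norm_inv, Real.norm_of_nonneg hr.le, inv_mul_le_iff₀ hr]; linarith
      · rw [norm_smul, norm_inv, Real.norm_of_nonneg hR.le, inv_mul_le_iff₀ hR]; linarith)
    simp only [sub_apply, mul_sub] at this
    rw [integral_sub (hint _) (hint _)] at this
    exact sub_eq_zero.1 this
  have hone : ∫ z, ψ z = 1 := by
    have := hψ 0 (by simp)
    simpa [Real.fourier_eq] using this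
  have lim : Tendsto (fun R : ℝ => ∫ z, u (w + R⁻¹ • z) * ψ z) atTop (𝓝 (∫ z, u w * ψ z)) := by
    apply tendsto_integral_filter_of_dominated_convergence (fun z => B * ‖ψ z‖)
    · refine Eventually.of_forall fun R => ?_
      exact ((hu.comp (by fun_prop)).mul ψ.continuous).aestronglyMeasurable
    · refine Eventually.of_forall fun R => Eventually.of_forall fun z => ?_
      rw [norm_mul]
      gcongr
      exact hB _
    · exact ψ.integrable.norm.const_mul B
    · refine Eventually.of_forall fun z => ?_
      refine Tendsto.mul_const _ ((hu.tendsto w).comp ?_)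
      have : Tendsto (fun R : ℝ => w + R⁻¹ • z) atTop (𝓝 (w + (0:ℝ) • z)) :=
        tendsto_const_nhds.add (tendsto_inv_atTop_zero.smul_const z)
      simpa using this
  rw [integral_const_mul, hone, mul_one] at lim
  refine tendsto_nhds_unique lim (tendsto_const_nhds.congr' ?_)
  filter_upwards [eventually_ge_atTop r] with R hR
  exact (step R hR).symm

/-- Pointwise Lipschitz decay of a Schwartz function. -/
theorem aux_lip {d : ℕ} (ψ : SchwartzMap (Ed d) ℂ) (N : ℕ) : ∃ C : ℝ, 0 ≤ C ∧ ∀ z h : Ed d, ‖h‖ ≤ 1 →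
    ‖ψ z - ψ (z - h)‖ ≤ C * ‖h‖ * ((1 + ‖z‖) ^ N)⁻¹ := by
  set S : ℝ := 2 ^ N * ((Finset.Iic (N, 1)).sup fun m => SchwartzMap.seminorm ℝ m.1 m.2) ψ with hS
  have hder : ∀ x, (1 + ‖x‖) ^ N * ‖fderiv ℝ ψ x‖ ≤ S := by
    intro x
    have := SchwartzMap.one_add_le_sup_seminorm_apply (𝕜 := ℝ) (m := (N, 1)) (k := N) (n := 1)
      le_rfl le_rfl ψ x
    rwa [norm_iteratedFDeriv_one] at this
  have hS0 : 0 ≤ S := by positivity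
  refine ⟨2 ^ N * S, by positivity, fun z h hh => ?_⟩
  have hb : ∀ x ∈ segment ℝ (z - h) z, ‖fderiv ℝ ψ x‖ ≤ 2 ^ N * S * ((1 + ‖z‖) ^ N)⁻¹ := by
    intro x hx
    have hxz : ‖z‖ ≤ ‖x‖ + 1 := by
      have h1 : x ∈ Metric.closedBall z 1 := by
        refine (convex_closedBall z 1).segment_subset ?_ ?_ hx
        · simpa using hh
        · simp
      have h2 : ‖x - z‖ ≤ 1 := by simpa [dist_eq_norm] using h1
      have := norm_le_norm_add_norm_sub' z x
      rw [norm_sub_rev] at this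
      linarith
    have h3 : (1 + ‖z‖) ^ N ≤ 2 ^ N * (1 + ‖x‖) ^ N := by
      rw [← mul_pow]
      gcongr
      have := norm_nonneg x
      linarith
    rw [← div_eq_mul_inv, le_div_iff₀ (by positivity)]
    calc ‖fderiv ℝ ψ x‖ * (1 + ‖z‖) ^ N ≤ ‖fderiv ℝ ψ x‖ * (2 ^ N * (1 + ‖x‖) ^ N) := by gcongr
      _ = 2 ^ N * ((1 + ‖x‖) ^ N * ‖fderiv ℝ ψ x‖) := by ring
      _ ≤ _ := by gcongr; exact hder x
  have := (convex_segment (𝕜 := ℝ) (z - h) z).norm_image_sub_le_of_norm_fderiv_le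
    (f := ψ) (fun x _ => ψ.differentiableAt) hb (left_mem_segment _ _ _) (right_mem_segment _ _ _)
  rw [sub_sub_cancel] at this
  linarith

/-- Weighted integral bound. -/
theorem aux_K {d : ℕ} (ψ : SchwartzMap (Ed d) ℂ) (σ : ℝ) : ∃ K : ℝ, 0 ≤ K ∧
    ∀ h : Ed d, ‖h‖ ≤ 1 → ∃ g : Ed d → ℝ, Integrable g ∧ (∫ z, g z) ≤ K * ‖h‖ ∧
      ∀ z, (1 + ‖z‖) ^ σ * ‖ψ z - ψ (z - h)‖ ≤ g z := by
  obtain ⟨N, hN⟩ := exists_nat_gt (σ + d)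
  obtain ⟨C, hC, hl⟩ := aux_lip ψ N
  have hi : Integrable (fun z : Ed d => (1 + ‖z‖) ^ (-(N - σ))) := by
    apply integrable_one_add_norm
    simp; linarith
  refine ⟨C * ∫ z : Ed d, (1 + ‖z‖) ^ (-(N - σ)), ?_, fun h hh =>
    ⟨fun z => C * ‖h‖ * (1 + ‖z‖) ^ (-(N - σ)), hi.const_mul _, ?_, fun z => ?_⟩⟩
  · exact mul_nonneg hC (integral_nonneg fun z => by positivity)
  · rw [integral_const_mul]; apply le_of_eq; ring
  · have hz : 0 < 1 + ‖z‖ := by positivity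
    calc _ ≤ (1 + ‖z‖) ^ σ * (C * ‖h‖ * ((1 + ‖z‖) ^ N)⁻¹) := by gcongr; exact hl z h hh
      _ = _ := by
        beta_reduce
        rw [neg_sub, Real.rpow_sub hz, Real.rpow_natCast]; ring

theorem aux_HLM {d : ℕ} (f : Ed d → ℝ) (hf : Continuous f) (hf0 : ∀ z, 0 ≤ f z) (B : ℝ)
    (hB : ∀ z, f z ≤ B) (x w : Ed d) (ρ : ℝ) (hρ : 0 < ρ) :
    ∃ z ∈ Metric.ball w ρ, ρ ^ d * f z ≤ (‖w - x‖ + ρ) ^ d * HLM d f x := by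
  have hint : ∀ y s, IntegrableOn f (Metric.ball y s) := fun y s =>
    (hf.continuousOn.integrableOn_compact (isCompact_closedBall y s)).mono_set
      Metric.ball_subset_closedBall
  have hvol : ∀ (y : Ed d) (s : ℝ), 0 < s → (volume (Metric.ball y s)).toReal =
      s ^ d * (volume (Metric.ball (0 : Ed d) 1)).toReal := by
    intro y s hs
    rw [Measure.addHaar_ball_of_pos _ _ hs, ENNReal.toReal_mul, ENNReal.toReal_ofReal (by positivity)]
    simp
  have hV : 0 < (volume (Metric.ball (0 : Ed d) 1)).toReal :=
    ENNReal.toReal_pos (Metric.measure_ball_pos _ _ one_pos).ne' measure_ball_lt_top.ne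
  set V := (volume (Metric.ball (0 : Ed d) 1)).toReal
  have hbdd : BddAbove (Set.range fun R : {R : ℝ // 0 < R} => ballAvg d f x R.1) := by
    refine ⟨B, ?_⟩
    rintro _ ⟨⟨R, hR⟩, rfl⟩
    simp only [ballAvg]
    rw [inv_mul_le_iff₀ (by rw [hvol _ _ hR]; positivity)]
    calc ∫ z in Metric.ball x R, f z ≤ ∫ z in Metric.ball x R, B :=
          setIntegral_mono (hint _ _) (integrableOn_const measure_ball_lt_top.ne) hB
      _ = _ := by simp [Measure.real]
  obtain ⟨z, hz, hzl⟩ := exists_le_setAverage (μ := volume) (f := f) (s := Metric.ball w ρ)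
    (Metric.measure_ball_pos _ _ hρ).ne' measure_ball_lt_top.ne (hint _ _)
  refine ⟨z, hz, ?_⟩
  rw [setAverage_eq, smul_eq_mul, Measure.real, hvol _ _ hρ] at hzl
  have hρ' : 0 < ‖w - x‖ + ρ := by positivity
  have h1 := le_ciSup hbdd ⟨‖w - x‖ + ρ, hρ'⟩
  change ballAvg d f x (‖w - x‖ + ρ) ≤ HLM d f x at h1
  rw [ballAvg, hvol _ _ hρ', inv_mul_le_iff₀ (by positivity)] at h1
  have hsub : Metric.ball w ρ ⊆ Metric.ball x (‖w - x‖ + ρ) := by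
    apply Metric.ball_subset_ball'
    rw [dist_eq_norm]; linarith
  have h2 : ∫ z in Metric.ball w ρ, f z ≤ ∫ z in Metric.ball x (‖w - x‖ + ρ), f z :=
    setIntegral_mono_set (hint _ _) (Eventually.of_forall hf0) hsub.eventuallyLE
  rw [le_inv_mul_iff₀ (by positivity)] at hzl
  have h3 : V * (ρ ^ d * f z) ≤ V * ((‖w - x‖ + ρ) ^ d * HLM d f x) := by linarith
  exact le_of_mul_le_mul_left h3 hV

/-- Peetre's maximal inequality: for a bounded continuous function `u`
with Fourier transform supported in `{|ξ| ≤ 2r}`, and `σ ≥ d/t`,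
`sup_y |u(x+y)|/(1+r|y|)^σ ≤ C (M(|u|^t)(x))^{1/t}`. -/
theorem peetre_maximal_inequality (d : ℕ) (t σ : ℝ) (ht : 0 < t) (hσ : (d:ℝ) / t ≤ σ) :
    ∃ C : ℝ, ∀ r : ℝ, 0 < r → ∀ u : Ed d → ℂ, Continuous u →
      (∃ B : ℝ, ∀ x : Ed d, ‖u x‖ ≤ B) →
      (∀ φ : SchwartzMap (Ed d) ℂ,
        (∀ ξ : Ed d, ‖ξ‖ ≤ 2 * r → 𝓕 ⇑φ ξ = 0) → (∫ x : Ed d, u x * φ x) = 0) →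
      ∀ x y : Ed d,
        ‖u (x + y)‖ / (1 + r * ‖y‖) ^ σ ≤
          C * (HLM d (fun z => ‖u z‖ ^ t) x) ^ (1 / t) := by
  obtain ⟨ψ, hψ⟩ := aux_psi d
  set s : ℝ := d / t with hs
  have hs0 : 0 ≤ s := by positivity
  obtain ⟨K, hK, hKg⟩ := aux_K ψ s
  set δ : ℝ := 1 / (2 * K + 2) with hδ
  have hδ0 : 0 < δ := by positivity
  have hδ1 : δ ≤ 1 := by rw [hδ, div_le_one (by positivity)]; linarith
  have hKδ : K * δ ≤ 1 / 2 := by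
    rw [hδ, mul_one_div, div_le_iff₀ (by positivity)]; linarith
  refine ⟨2 * (δ ^ s)⁻¹, ?_⟩
  rintro r hr u hu ⟨B, hB⟩ hF x y
  have hB0 : 0 ≤ B := (norm_nonneg _).trans (hB x)
  have hrep := aux_repr ψ hψ r hr u hu B hB hF
  set M := HLM d (fun z => ‖u z‖ ^ t) x with hM
  have hM0 : 0 ≤ M := by
    refine Real.iSup_nonneg fun R => ?_
    refine mul_nonneg (by positivity) (integral_nonneg fun z => by positivity)
  have hge : ∀ y : Ed d, 1 ≤ 1 + r * ‖y‖ := fun y => by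
    have : 0 ≤ r * ‖y‖ := by positivity
    linarith
  have hpos : ∀ y : Ed d, 0 < (1 + r * ‖y‖) ^ s := fun y => by positivity
  have hbdd : BddAbove (Set.range fun y : Ed d => ‖u (x + y)‖ / (1 + r * ‖y‖) ^ s) := by
    refine ⟨B, ?_⟩
    rintro _ ⟨y, rfl⟩
    exact (div_le_self (norm_nonneg _) (Real.one_le_rpow (hge y) hs0)).trans (hB _)
  set A : ℝ := ⨆ y : Ed d, ‖u (x + y)‖ / (1 + r * ‖y‖) ^ s with hA
  have hA0 : 0 ≤ A := Real.iSup_nonneg fun y => by positivity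
  have hAle : ∀ y : Ed d, ‖u (x + y)‖ ≤ A * (1 + r * ‖y‖) ^ s := fun y => by
    rw [← div_le_iff₀ (hpos y)]
    exact le_ciSup hbdd y
  have key : ∀ y : Ed d, ‖u (x + y)‖ / (1 + r * ‖y‖) ^ s ≤ (δ ^ s)⁻¹ * M ^ (1 / t) + 1 / 2 * A := by
    intro y
    rw [div_le_iff₀ (hpos y)]
    obtain ⟨z, hz, hzl⟩ := aux_HLM (fun z => ‖u z‖ ^ t) (by
      exact hu.norm.rpow_const (fun _ => Or.inr ht.le)) (fun z => by positivity) (B ^ t)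
      (fun z => Real.rpow_le_rpow (norm_nonneg _) (hB z) ht.le) x (x + y) (δ / r) (by positivity)
    rw [← hM, add_sub_cancel_left] at hzl
    -- bound for `u z`
    have huz : ‖u z‖ ≤ (δ ^ s)⁻¹ * M ^ (1 / t) * (1 + r * ‖y‖) ^ s := by
      have h1 : ‖u z‖ ^ t ≤ ((1 + r * ‖y‖) / δ) ^ d * M := by
        have e1 : (‖y‖ + δ / r) ^ d ≤ (δ / r) ^ d * ((1 + r * ‖y‖) / δ) ^ d := by
          rw [← mul_pow]
          gcongr
          have : δ / r * ((1 + r * ‖y‖) / δ) = ‖y‖ + 1 / r := by field_simp; ring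
          rw [this]; gcongr
        have e2 : (δ / r) ^ d * ‖u z‖ ^ t ≤ (δ / r) ^ d * (((1 + r * ‖y‖) / δ) ^ d * M) := by
          rw [← mul_assoc]
          exact hzl.trans (mul_le_mul_of_nonneg_right e1 hM0)
        exact le_of_mul_le_mul_left e2 (by positivity)
      have h2 := Real.rpow_le_rpow (by positivity) h1 (by positivity : 0 ≤ 1 / t)
      rw [← Real.rpow_mul (norm_nonneg _), mul_one_div_cancel ht.ne', Real.rpow_one,
        Real.mul_rpow (by positivity) hM0, ← Real.rpow_natCast, ← Real.rpow_mul (by positivity),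
        mul_one_div, ← hs, Real.div_rpow (by positivity) hδ0.le] at h2
      calc _ ≤ _ := h2
        _ = _ := by ring
    -- oscillation
    set h : Ed d := r • (z - (x + y)) with hh
    have hhn : ‖h‖ ≤ δ := by
      rw [hh, norm_smul, Real.norm_of_nonneg hr.le]
      have : ‖z - (x + y)‖ < δ / r := by simpa [dist_eq_norm] using hz
      rw [lt_div_iff₀ hr] at this
      linarith
    obtain ⟨g, hg, hgi, hgl⟩ := hKg h (hhn.trans hδ1)
    have hzrep : u z = ∫ v, u (x + y + r⁻¹ • v) * ψ (v - h) := by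
      rw [hrep z, ← integral_sub_right_eq_self _ h]
      congr 1; ext v
      congr 2
      rw [hh, smul_sub, smul_smul, inv_mul_cancel₀ hr.ne', one_smul]
      abel
    have hcont : Continuous fun v : Ed d => u (x + y + r⁻¹ • v) := hu.comp (by fun_prop)
    have hosc : ‖u (x + y) - u z‖ ≤ A * (1 + r * ‖y‖) ^ s * (K * δ) := by
      rw [hrep (x + y), hzrep, ← integral_sub
        (ψ.integrable.bdd_mul hcont.aestronglyMeasurable (Eventually.of_forall fun v => hB _))
        ((ψ.integrable.comp_sub_right h).bdd_mul hcont.aestronglyMeasurable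
          (Eventually.of_forall fun v => hB _))]
      calc _ ≤ ∫ v, A * (1 + r * ‖y‖) ^ s * g v := by
            refine norm_integral_le_of_norm_le (hg.const_mul _) (Eventually.of_forall fun v => ?_)
            rw [← mul_sub, norm_mul]
            have h1 : ‖u (x + y + r⁻¹ • v)‖ ≤ A * ((1 + r * ‖y‖) ^ s * (1 + ‖v‖) ^ s) := by
              rw [add_assoc]
              refine (hAle _).trans ?_
              rw [← Real.mul_rpow (by positivity) (by positivity)]
              gcongr
              have h2 : ‖y + r⁻¹ • v‖ ≤ ‖y‖ + r⁻¹ * ‖v‖ := by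
                refine (norm_add_le _ _).trans ?_
                rw [norm_smul, norm_inv, Real.norm_of_nonneg hr.le]
              have h3 : r * ‖y + r⁻¹ • v‖ ≤ r * ‖y‖ + ‖v‖ := by
                calc _ ≤ r * (‖y‖ + r⁻¹ * ‖v‖) := by gcongr
                  _ = _ := by field_simp
              have h4 : 0 ≤ r * ‖y‖ * ‖v‖ := by positivity
              linarith
            calc _ ≤ A * ((1 + r * ‖y‖) ^ s * (1 + ‖v‖) ^ s) * ‖ψ v - ψ (v - h)‖ := by gcongr
              _ = A * (1 + r * ‖y‖) ^ s * ((1 + ‖v‖) ^ s * ‖ψ v - ψ (v - h)‖) := by ring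
              _ ≤ _ := by gcongr; exact hgl v
        _ ≤ A * (1 + r * ‖y‖) ^ s * (K * δ) := by
            rw [integral_const_mul]
            gcongr
            exact hgi.trans (by gcongr)
    have h5 : A * (1 + r * ‖y‖) ^ s * (K * δ) ≤ A * (1 + r * ‖y‖) ^ s * (1 / 2) := by gcongr
    have h6 := norm_le_norm_add_norm_sub' (u (x + y)) (u z)
    linarith
  have hAfin : A ≤ (δ ^ s)⁻¹ * M ^ (1 / t) + 1 / 2 * A := ciSup_le key
  calc ‖u (x + y)‖ / (1 + r * ‖y‖) ^ σ ≤ ‖u (x + y)‖ / (1 + r * ‖y‖) ^ s := by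
        gcongr
        exact hge y
    _ ≤ A := le_ciSup hbdd y
    _ ≤ _ := by linarith
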